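/- Minimum distance bound: let M(t) be a planar motion with constant speed v > 0 and heading rate bounded by ρ > 0 (|θ'(t)| ≤ ρ), starting at the origin. Then for all t with 0 ≤ t < 2/ρ, the distance R(t) from the origin satisfies R(t) ≥ (2v/ρ)·sin(ρ·t/2). -/

import Mathlib

/-- The component of a planar vector along a unit direction is at most its length. -/
lemma mul_cos_add_mul_sin_le_sqrt (a b φ : ℝ) :
    a * Real.cos φ + b * Real.sin φ ≤ Real.sqrt (a ^ 2 + b ^ 2) := by
  apply Real.le_sqrt_of_sq_le
  have h : (a * Real.cos φ + b * Real.sin φ) ^ 2 + (a * Real.sin φ - b * Real.cos φ) ^ 2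
      = (a ^ 2 + b ^ 2) * (Real.sin φ ^ 2 + Real.cos φ ^ 2) := by ring
  rw [Real.sin_sq_add_cos_sq, mul_one] at h
  linarith [sq_nonneg (a * Real.sin φ - b * Real.cos φ)]

theorem min_distance_bound (v ρ : ℝ) (hv : v > 0) (hρ : ρ > 0)
    (x y θ : ℝ → ℝ)
    (hx0 : x 0 = 0) (hy0 : y 0 = 0)
    (hx : Differentiable ℝ x) (hy : Differentiable ℝ y) (hθ : Differentiable ℝ θ)
    (hx' : ∀ t, deriv x t = v * Real.cos (θ t))
    (hy' : ∀ t, deriv y t = v * Real.sin (θ t))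
    (hθ' : ∀ t, |deriv θ t| ≤ ρ) :
    ∀ t, 0 ≤ t → t < 2 / ρ →
      Real.sqrt (x t ^ 2 + y t ^ 2) ≥ (2 * v / ρ) * Real.sin (ρ * t / 2) := by
  intro T hT0 hT
  have hρT : ρ * T < 2 := by rwa [lt_div_iff₀' hρ] at hT
  set φ := θ (T / 2)
  have hturn (s : ℝ) : |θ s - φ| ≤ ρ * |s - T / 2| := by
    simpa only [Real.norm_eq_abs] using
      convex_univ.norm_image_sub_le_of_norm_deriv_le (fun u _ ↦ hθ u) (fun u _ ↦ hθ' u)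
        (Set.mem_univ (T / 2)) (Set.mem_univ s)
  let g : ℝ → ℝ := fun s ↦
    x s * Real.cos φ + y s * Real.sin φ - v / ρ * Real.sin (ρ * (s - T / 2))
  have hg (s : ℝ) :
      HasDerivAt g (v * (Real.cos (θ s - φ) - Real.cos (ρ * (s - T / 2)))) s := by
    have hxs := (hx s).hasDerivAt.mul_const (Real.cos φ)
    have hys := (hy s).hasDerivAt.mul_const (Real.sin φ)
    have hsin := ((((hasDerivAt_id s).sub_const (T / 2)).const_mul ρ).sin).const_mul (v / ρ)
    refine ((hxs.add hys).sub hsin).congr_deriv ?_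
    rw [hx', hy', Real.cos_sub]
    simp only [id]
    field_simp
  have hmono : MonotoneOn g (Set.Icc 0 T) := by
    refine monotoneOn_of_deriv_nonneg (convex_Icc 0 T)
      (fun s _ ↦ (hg s).continuousAt.continuousWithinAt)
      (fun s _ ↦ (hg s).differentiableAt.differentiableWithinAt) fun s hs ↦ ?_
    obtain ⟨hs0, hsT⟩ := interior_subset hs
    rw [(hg s).deriv]
    refine mul_nonneg hv.le (sub_nonneg.2 ?_)
    rw [← Real.cos_abs (θ s - φ), ← Real.cos_abs (ρ * _), abs_mul, abs_of_pos hρ]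
    refine Real.cos_le_cos_of_nonneg_of_le_pi (abs_nonneg _) ?_ (hturn s)
    have hsmid : |s - T / 2| ≤ T / 2 := abs_le.2 ⟨by linarith, by linarith⟩
    nlinarith [Real.pi_gt_three]
  have hends : g 0 ≤ g T := hmono ⟨le_rfl, hT0⟩ ⟨hT0, le_rfl⟩ hT0
  have h0 : ρ * (0 - T / 2) = -(ρ * T / 2) := by ring
  have h1 : ρ * (T - T / 2) = ρ * T / 2 := by ring
  simp only [g, hx0, hy0, h0, h1, Real.sin_neg] at hends
  have hproj := mul_cos_add_mul_sin_le_sqrt (x T) (y T) φ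
  have htwo : 2 * v / ρ * Real.sin (ρ * T / 2) = 2 * (v / ρ * Real.sin (ρ * T / 2)) := by ring
  linarith
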